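/- arXiv:2105.09635 — 2 statements merged into one kernel-verified Lean document; each statement's English description precedes it below -/
import Mathlib

section
/- Let d ≥ 5 and let P ⊂ ℝ^d be a d-dimensional canonical lattice simplex. Then mult(P) ≤ 3·(s_{d-1} − 1)², where s_i denotes the Sylvester sequence. -/
/-- Shifted Sylvester sequence: `sylv n` is the Sylvester number `s (n+1)`,
so `sylv 0 = s 1 = 2`, `sylv 1 = s 2 = 3`, `sylv 2 = s 3 = 7`, `sylv 3 = s 4 = 43`, …
It satisfies `s (i+1) = s i * (s i - 1) + 1 = s 1 * ⋯ * s i + 1`. -/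
def sylv : ℕ → ℕ
  | 0 => 2
  | n + 1 => sylv n * (sylv n - 1) + 1

/-- The canonical embedding of integer vectors into real vectors. -/
def toR {d : ℕ} (x : Fin d → ℤ) : Fin d → ℝ := fun j => (x j : ℝ)

/-- The lattice simplex (as a subset of `ℝ^d`) with vertex family `v`. -/
def hullOf {d : ℕ} (v : Fin (d + 1) → Fin d → ℤ) : Set (Fin d → ℝ) :=
  convexHull ℝ (Set.range fun i => toR (v i))

/-- `v` is the vertex family of a `d`-dimensional canonical lattice simplex:
the vertices are affinely independent lattice points, the origin lies in the
interior, and the origin is the only lattice point in the interior. -/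
def IsCanonicalSimplex {d : ℕ} (v : Fin (d + 1) → Fin d → ℤ) : Prop :=
  AffineIndependent ℝ (fun i => toR (v i)) ∧
  (0 : Fin d → ℝ) ∈ interior (hullOf v) ∧
  ∀ x : Fin d → ℤ, toR x ∈ interior (hullOf v) → x = 0

/-- The multiplicity of the lattice simplex with vertex family `v`: the index in
`ℤ^d` of the subgroup generated by the vertices. -/
noncomputable def mult {d : ℕ} (v : Fin (d + 1) → Fin d → ℤ) : ℕ :=
  (AddSubgroup.closure (Set.range v)).index


section SylvesterSequence

lemma two_le_sylv (k : ℕ) : 2 ≤ sylv k := by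
  induction k with
  | zero => simp [sylv]
  | succ k ih =>
    obtain ⟨m, hm⟩ := Nat.exists_eq_add_of_le ih
    simp only [sylv, hm, show 2 + m - 1 = m + 1 by omega]
    nlinarith

/-- The number `s_{k+1} - 1`, as a real number. -/
noncomputable def sylvPred (k : ℕ) : ℝ := (sylv k : ℝ) - 1

lemma sylvPred_zero : sylvPred 0 = 1 := by norm_num [sylvPred, sylv]

lemma sylvPred_succ (k : ℕ) : sylvPred (k + 1) = sylvPred k * (sylvPred k + 1) := by
  have h := two_le_sylv k
  simp only [sylvPred, sylv]
  rw [Nat.cast_add, Nat.cast_mul, Nat.cast_sub (by omega)]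
  push_cast
  ring

lemma one_le_sylvPred (k : ℕ) : 1 ≤ sylvPred k := by
  have h : (2 : ℝ) ≤ sylv k := by exact_mod_cast two_le_sylv k
  simp only [sylvPred]
  linarith

lemma sylvPred_pos (k : ℕ) : 0 < sylvPred k := zero_lt_one.trans_le (one_le_sylvPred k)

lemma six_le_sylvPred {k : ℕ} (hk : 2 ≤ k) : 6 ≤ sylvPred k := by
  induction k, hk using Nat.le_induction with
  | base => norm_num [sylvPred_succ, sylvPred_zero]
  | succ k _ ih =>
    rw [sylvPred_succ]
    nlinarith

lemma one_div_sylvPred_succ (k : ℕ) :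
    1 / sylvPred (k + 1) = 1 / sylvPred k - 1 / (sylvPred k + 1) := by
  have h := sylvPred_pos k
  rw [sylvPred_succ]
  field_simp
  ring

lemma sum_one_div_sylv (k : ℕ) :
    ∑ i ∈ Finset.range k, 1 / (sylvPred i + 1) = 1 - 1 / sylvPred k := by
  induction k with
  | zero => simp [sylvPred_zero]
  | succ k ih =>
    rw [Finset.sum_range_succ, ih, one_div_sylvPred_succ]
    ring

lemma prod_one_div_sylv (k : ℕ) :
    ∏ i ∈ Finset.range k, 1 / (sylvPred i + 1) = 1 / sylvPred k := by
  induction k with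
  | zero => simp [sylvPred_zero]
  | succ k ih =>
    rw [Finset.prod_range_succ, ih, sylvPred_succ, one_div_mul_one_div]

lemma mul_add_two_pow_le {a : ℝ} (ha : 1 ≤ a) {e : ℕ} (he : 3 ≤ e) :
    a * ((e : ℝ) + 2) ^ e ≤ (a + 1) ^ e * ((e : ℝ) + 1) ^ (e - 1) := by
  induction e, he using Nat.le_induction with
  | base => norm_num; nlinarith [sq_nonneg (a - 1)]
  | succ e he ih =>
    obtain ⟨m, rfl⟩ : ∃ m, e = m + 1 := ⟨e - 1, by omega⟩
    simp only [Nat.add_sub_cancel] at ih ⊢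
    push_cast at ih ⊢
    have hm : (2 : ℝ) ≤ m := by exact_mod_cast (by omega : 2 ≤ m)
    have h2 : (((m : ℝ) + 1 + 1 + 2) * (m + 1 + 1)) ^ m ≤ ((m + 1 + 2) ^ 2) ^ m := by
      apply pow_le_pow_left₀ (by positivity)
      nlinarith
    have h3 : ((m : ℝ) + 1 + 1 + 2) ^ 2 ≤ (a + 1) * (m + 1 + 2) ^ 2 := by nlinarith
    refine le_of_mul_le_mul_right ?_ (show (0 : ℝ) < (m + 1 + 1) ^ m * (m + 1 + 2) ^ (m + 1) by
      positivity)
    calc a * ((m : ℝ) + 1 + 1 + 2) ^ (m + 1 + 1) * ((m + 1 + 1) ^ m * (m + 1 + 2) ^ (m + 1))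
        = (a * ((m : ℝ) + 1 + 2) ^ (m + 1)) * ((((m : ℝ) + 1 + 1 + 2) * (m + 1 + 1)) ^ m
          * ((m : ℝ) + 1 + 1 + 2) ^ 2) := by rw [mul_pow]; ring
      _ ≤ ((a + 1) ^ (m + 1) * ((m : ℝ) + 1 + 1) ^ m) * (((m + 1 + 2) ^ 2) ^ m
          * ((a + 1) * (m + 1 + 2) ^ 2)) := by gcongr
      _ = _ := by rw [← pow_mul]; ring

/-- Among the products arising from replacing the tail of the Sylvester sequence by equal numbers,
the latest possible replacement gives the smallest product. -/
lemma sylvPred_pow_mul_pow_le {n : ℕ} (hn : 3 ≤ n) {e k : ℕ} (hek : e + 1 + k = n + 1) :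
    sylvPred k ^ (e + 2) * ((e : ℝ) + 3) ^ (e + 1) ≤ 3 * sylvPred n ^ 2 := by
  induction e generalizing k with
  | zero =>
    obtain rfl : k = n := by omega
    norm_num
    linarith
  | succ e ih =>
    refine le_trans ?_ (ih (k := k + 1) (by omega))
    have ha := one_le_sylvPred k
    rw [sylvPred_succ]
    set a := sylvPred k
    have key : a * ((e : ℝ) + 4) ^ (e + 2) ≤ (a + 1) ^ (e + 2) * ((e : ℝ) + 3) ^ (e + 1) := by
      rcases Nat.eq_zero_or_pos e with rfl | he
      · have : 6 ≤ a := six_le_sylvPred (by omega)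
        norm_num
        nlinarith
      · have := mul_add_two_pow_le ha (e := e + 2) (by omega)
        push_cast at this
        convert this using 2 <;> ring
    calc a ^ (e + 1 + 2) * (((e + 1 : ℕ) : ℝ) + 3) ^ (e + 1 + 1)
        = a ^ (e + 2) * (a * ((e : ℝ) + 4) ^ (e + 2)) := by push_cast; ring
      _ ≤ a ^ (e + 2) * ((a + 1) ^ (e + 2) * ((e : ℝ) + 3) ^ (e + 1)) := by gcongr
      _ = _ := by rw [mul_pow]; ring

end SylvesterSequence

section ProductSum

open Finset

lemma prod_le_prod_mul_exp {ι : Type*} (s : Finset ι) {x y : ι → ℝ} (hx : ∀ i ∈ s, 0 < x i)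
    (hy : ∀ i ∈ s, 0 ≤ y i) :
    ∏ i ∈ s, y i ≤ (∏ i ∈ s, x i) * Real.exp (∑ i ∈ s, (y i - x i) / x i) := by
  rw [Real.exp_sum, ← prod_mul_distrib]
  refine prod_le_prod hy fun i hi => ?_
  have h := mul_le_mul_of_nonneg_left (Real.add_one_le_exp ((y i - x i) / x i)) (hx i hi).le
  have h0 := (hx i hi).ne'
  rwa [show x i * ((y i - x i) / x i + 1) = y i by field_simp; ring] at h

lemma sum_sub_div_le {x y : ℕ → ℝ} {k : ℕ} (hpos : ∀ i ≤ k, 0 < x i)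
    (hanti : ∀ i < k, x (i + 1) ≤ x i)
    (hsum : ∀ j ≤ k, ∑ i ∈ range j, x i ≤ ∑ i ∈ range j, y i) :
    ∑ i ∈ range (k + 1), (y i - x i) / x i ≤ (∑ i ∈ range (k + 1), (y i - x i)) / x k := by
  induction k with
  | zero => simp
  | succ k ih =>
    rw [sum_range_succ, sum_range_succ (fun i => y i - x i), add_div]
    have h := ih (fun i hi => hpos i (by omega)) (fun i hi => hanti i (by omega))
      fun j hj => hsum j (by omega)
    have h0 : 0 ≤ ∑ i ∈ range (k + 1), (y i - x i) := by
      rw [sum_sub_distrib]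
      linarith [hsum (k + 1) le_rfl]
    have h1 := div_le_div_of_nonneg_left h0 (hpos (k + 1) le_rfl) (hanti k (by omega))
    linarith

/-- A decreasing sequence satisfying the product-sum inequalities leaves at least as large a
remainder as the reciprocals of the Sylvester sequence do. -/
lemma one_div_sylvPred_le {x : ℕ → ℝ} {n : ℕ} (hpos : ∀ i < n, 0 < x i)
    (hanti : ∀ i, i + 1 < n → x (i + 1) ≤ x i)
    (hps : ∀ j ≤ n, ∏ i ∈ range j, x i ≤ 1 - ∑ i ∈ range j, x i) :
    ∀ j ≤ n, 1 / sylvPred j ≤ 1 - ∑ i ∈ range j, x i := by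
  intro j
  induction j using Nat.strong_induction_on with
  | _ j ih =>
    intro hj
    rcases j with _ | k
    · simp [sylvPred_zero]
    by_contra! hlt
    have hA := sum_sub_div_le (x := x) (y := fun i => 1 / (sylvPred i + 1)) (k := k)
      (fun i hi => hpos i (by omega)) (fun i hi => hanti i (by omega)) fun j' hj' => by
        rw [sum_one_div_sylv]
        linarith [ih j' (by omega) (by omega)]
    have hneg : (∑ i ∈ range (k + 1), (1 / (sylvPred i + 1) - x i)) / x k < 0 := by
      apply div_neg_of_neg_of_pos _ (hpos k (by omega))
      rw [sum_sub_distrib, sum_one_div_sylv]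
      linarith
    have hB := prod_le_prod_mul_exp (range (k + 1)) (x := x) (y := fun i => 1 / (sylvPred i + 1))
      (fun i hi => hpos i (by simp at hi; omega)) fun i _ => by
        have := sylvPred_pos i
        positivity
    have hC : 0 < ∏ i ∈ range (k + 1), x i := prod_pos fun i hi => hpos i (by simp at hi; omega)
    have hD := mul_le_of_le_one_right hC.le (Real.exp_le_one_iff.2 (hA.trans hneg.le))
    rw [prod_one_div_sylv] at hB
    linarith [hps (k + 1) hj]

lemma pow_le_mul_pow {x u : ℝ} {e : ℕ} (hu : 0 < u) (hux : u ≤ x) (hxu : e * x ≤ (e + 2) * u) :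
    ((x + (e + 2) * u) / (e + 3)) ^ (e + 1) ≤ x * u ^ e := by
  have hx : 0 < x := hu.trans_le hux
  set M := (x + (e + 2) * u) / (e + 3) with hM
  have hM0 : 0 < M := by positivity
  have hMe : M * (e + 3) = x + (e + 2) * u := by rw [hM]; field_simp
  have hB := one_add_mul_le_pow (a := u / M - 1) (by
    have : 0 < u / M := by positivity
    linarith) (e + 1)
  rw [add_sub_cancel] at hB
  have hle : u / x ≤ 1 + ((e + 1 : ℕ) : ℝ) * (u / M - 1) := by
    push_cast
    have : 1 + ((e : ℝ) + 1) * (u / M - 1) - u / x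
        = ((x - u) * ((e + 2) * u - e * x)) / (x * (M * (e + 3))) := by
      rw [hMe, hM]
      field_simp
      ring
    have h2 : 0 ≤ ((x - u) * ((e + 2) * u - e * x)) / (x * (M * (e + 3))) := by
      apply div_nonneg (mul_nonneg (by linarith) (by linarith)) (by positivity)
    linarith
  have h := hle.trans hB
  rw [div_pow, div_le_div_iff₀ hx (by positivity)] at h
  refine le_of_mul_le_mul_left ?_ hu
  calc u * M ^ (e + 1) ≤ u ^ (e + 1) * x := h
    _ = _ := by ring

/-- The main optimization: a lower bound for products of decreasing sequences satisfying the
product-sum inequalities. -/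
lemma one_div_le_prod {x : ℕ → ℝ} {n : ℕ} (hn : 3 ≤ n) (hpos : ∀ i < n, 0 < x i)
    (hanti : ∀ i, i + 1 < n → x (i + 1) ≤ x i)
    (hps : ∀ j ≤ n, ∏ i ∈ range j, x i ≤ 1 - ∑ i ∈ range j, x i)
    (htail : ∀ k < n, 1 - ∑ i ∈ range (k + 1), x i ≤ ((n - k : ℕ) + 2) * x k)
    (k e : ℕ) (hke : k + e = n) :
    1 / (3 * sylvPred n ^ 2) ≤
      (∏ i ∈ range k, x i) * ((1 - ∑ i ∈ range k, x i) / (e + 3)) ^ (e + 1) := by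
  have hrem := one_div_sylvPred_le hpos hanti hps
  induction k generalizing e with
  | zero =>
    have h := sylvPred_pow_mul_pow_le hn (e := e) (k := 0) (by omega)
    simp only [sylvPred_zero, one_pow, one_mul] at h
    simp only [range_zero, prod_empty, sum_empty, one_mul, sub_zero, one_div, inv_pow]
    exact inv_anti₀ (by positivity) h
  | succ k ih =>
    set r := 1 - ∑ i ∈ range (k + 1), x i with hr
    have hsp := sylvPred_pos (k + 1)
    have hr0 : 0 < r := lt_of_lt_of_le (by positivity) (hrem (k + 1) (by omega))
    have hxk := hpos k (by omega)
    have hP : 0 < ∏ i ∈ range k, x i := prod_pos fun i hi => hpos i (by simp at hi; omega)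
    rcases le_or_gt r ((e + 1) * x k) with hcase | hcase
    · set y : ℕ → ℝ := fun i => 1 / (sylvPred i + 1)
      set ρ := 1 / sylvPred (k + 1) with hρ
      have hρ0 : 0 < ρ := by positivity
      have hA := sum_sub_div_le (x := x) (y := y) (k := k)
        (fun i hi => hpos i (by omega)) (fun i hi => hanti i (by omega)) fun j hj => by
          rw [sum_one_div_sylv]
          linarith [hrem j (by omega)]
      have hD : ∑ i ∈ range (k + 1), (y i - x i) = r - ρ := by
        rw [sum_sub_distrib, sum_one_div_sylv, hr]
        ring
      have hρr : ρ ≤ r := hrem (k + 1) (by omega)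
      have hB := prod_le_prod_mul_exp (range (k + 1)) (x := x) (y := y)
        (fun i hi => hpos i (by simp at hi; omega)) fun i _ => by
          have := sylvPred_pos i
          positivity
      have hC := prod_le_prod_mul_exp (range (e + 1)) (x := fun _ => r) (y := fun _ => ρ)
        (fun _ _ => hr0) fun _ _ => hρ0.le
      simp only [prod_const, sum_const, card_range, nsmul_eq_mul] at hC
      have hexp : (∑ i ∈ range (k + 1), (y i - x i) / x i) + ((e + 1 : ℕ) : ℝ) * ((ρ - r) / r)
          ≤ 0 := by
        rw [hD] at hA
        have h1 : (r - ρ) / x k ≤ (e + 1) * ((r - ρ) / r) := by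
          rw [div_le_iff₀ hxk, mul_div_assoc', div_mul_eq_mul_div, le_div_iff₀ hr0]
          nlinarith [mul_le_mul_of_nonneg_left hcase (sub_nonneg.2 hρr)]
        have h2 : ((e + 1 : ℕ) : ℝ) * ((ρ - r) / r) = -((e + 1) * ((r - ρ) / r)) := by
          push_cast
          ring
        linarith
      have hE : ρ * ρ ^ (e + 1) ≤ (∏ i ∈ range (k + 1), x i) * r ^ (e + 1) := by
        rw [prod_one_div_sylv] at hB
        have hP' : 0 < ∏ i ∈ range (k + 1), x i := by
          rw [prod_range_succ]
          positivity
        calc ρ * ρ ^ (e + 1) ≤ _ := mul_le_mul hB hC (by positivity) (by positivity)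
          _ = ((∏ i ∈ range (k + 1), x i) * r ^ (e + 1)) *
              Real.exp ((∑ i ∈ range (k + 1), (y i - x i) / x i)
                + ((e + 1 : ℕ) : ℝ) * ((ρ - r) / r)) := by
            rw [Real.exp_add]
            ring
          _ ≤ _ := mul_le_of_le_one_right (by positivity) (Real.exp_le_one_iff.2 hexp)
      have hF := sylvPred_pow_mul_pow_le hn (e := e) (k := k + 1) (by omega)
      calc 1 / (3 * sylvPred n ^ 2)
          ≤ 1 / (sylvPred (k + 1) ^ (e + 2) * ((e : ℝ) + 3) ^ (e + 1)) :=
            one_div_le_one_div_of_le (by positivity) hF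
        _ = ρ * ρ ^ (e + 1) / ((e : ℝ) + 3) ^ (e + 1) := by
          rw [← pow_succ', hρ, one_div_pow, div_div]
        _ ≤ (∏ i ∈ range (k + 1), x i) * r ^ (e + 1) / ((e : ℝ) + 3) ^ (e + 1) := by gcongr
        _ = _ := by rw [div_pow, mul_div_assoc]
    · refine (ih (e + 1) (by omega)).trans ?_
      have ht := htail k (by omega)
      rw [show n - k = e + 1 by omega, ← hr] at ht
      push_cast at ht
      have hS : 1 - ∑ i ∈ range k, x i = x k + r := by
        rw [hr, sum_range_succ]
        ring
      have hpow := pow_le_mul_pow (x := x k) (u := r / (e + 3)) (e := e + 1) (by positivity)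
        (by rw [div_le_iff₀ (by positivity)]; linarith)
        (by
          push_cast
          rw [show ((e : ℝ) + 1 + 2) * (r / (e + 3)) = r by field_simp; ring]
          exact hcase.le)
      push_cast at hpow ⊢
      rw [show ((e : ℝ) + 1 + 2) * (r / (e + 3)) = r by field_simp; ring] at hpow
      rw [hS, prod_range_succ, mul_assoc]
      exact mul_le_mul_of_nonneg_left hpow hP.le

end ProductSum

section Geometry

open MeasureTheory Matrix Module

/-- Minkowski's theorem on linear forms. -/
lemma exists_int_ne_zero_abs_mulVec_lt {ι : Type*} [Fintype ι] [DecidableEq ι]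
    {A : Matrix ι ι ℝ} (hA : A.det ≠ 0) {c : ι → ℝ} (hc : ∀ i, 0 < c i)
    (h : |A.det| < ∏ i, c i) :
    ∃ z : ι → ℤ, z ≠ 0 ∧ ∀ i, |(A *ᵥ fun j => (z j : ℝ)) i| < c i := by
  let b := Pi.basisFun ℝ ι
  have hfund := ZSpan.isAddFundamentalDomain' b volume
  have : Countable (Submodule.span ℤ (Set.range b)).toAddSubgroup := by
    change Countable (Submodule.span ℤ (Set.range b))
    infer_instance
  set C : Set (ι → ℝ) := Set.univ.pi fun i => Set.Ioo (-c i) (c i) with hC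
  have hdet : LinearMap.det (Matrix.toLin' A) = A.det := LinearMap.det_toLin' A
  have hvol : volume (ZSpan.fundamentalDomain b) * 2 ^ finrank ℝ (ι → ℝ)
      < volume (Matrix.toLin' A ⁻¹' C) := by
    rw [Measure.addHaar_preimage_linearMap volume (by rwa [hdet]), hdet,
      ZSpan.volume_fundamentalDomain, hC, Real.volume_pi_Ioo, finrank_fintype_fun_eq_card]
    have hb : |(Matrix.of b).det| = 1 := by
      have : Matrix.of b = (1 : Matrix ι ι ℝ) := by
        ext i j
        simp [b, Matrix.one_apply, Pi.single_apply, eq_comm]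
      rw [this, det_one, abs_one]
    have h2 : ∀ i, c i - -c i = 2 * c i := fun i => by ring
    have hdet0 : 0 < |A.det| := abs_pos.2 hA
    simp only [hb, h2, ENNReal.ofReal_one, one_mul]
    rw [← ENNReal.ofReal_prod_of_nonneg (fun i _ => by linarith [hc i]),
      ← ENNReal.ofReal_mul (abs_nonneg _), Finset.prod_mul_distrib, Finset.prod_const,
      Finset.card_univ, show (2 : ENNReal) = ENNReal.ofReal 2 by simp,
      ← ENNReal.ofReal_pow (by norm_num), abs_inv, ENNReal.ofReal_lt_ofReal_iff_of_nonneg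
      (by positivity), mul_left_comm, inv_mul_eq_div]
    exact lt_mul_of_one_lt_right (by positivity) ((one_lt_div hdet0).2 h)
  have hsymm : ∀ y ∈ Matrix.toLin' A ⁻¹' C, -y ∈ Matrix.toLin' A ⁻¹' C := by
    intro y hy i _
    have hyi : -c i < Matrix.toLin' A y i ∧ Matrix.toLin' A y i < c i := hy i trivial
    rw [map_neg, Pi.neg_apply]
    exact ⟨neg_lt_neg hyi.2, neg_lt.1 hyi.1⟩
  obtain ⟨⟨x, hx⟩, hx0, hxC⟩ := exists_ne_zero_mem_lattice_of_measure_mul_two_pow_lt_measure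
    hfund hsymm
    ((convex_pi fun i _ => convex_Ioo _ _).linear_preimage (Matrix.toLin' A)) hvol
  rw [Submodule.mem_toAddSubgroup, Basis.mem_span_iff_repr_mem] at hx
  choose z hz using hx
  have hzx : (fun j => (z j : ℝ)) = x := by
    ext j
    simpa [b] using hz j
  refine ⟨z, ?_, fun i => ?_⟩
  · rintro rfl
    apply hx0
    ext j
    simp [← hzx]
  · rw [hzx, abs_lt]
    exact hxC i trivial

lemma det_one_sub_of_const {ι : Type*} [Fintype ι] [DecidableEq ι] (β : ι → ℝ) :
    (1 - Matrix.of fun i _ : ι => β i).det = 1 - ∑ i, β i := by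
  have h := det_one_add_replicateCol_mul_replicateRow (ι := Unit) (-β) (fun _ => (1 : ℝ))
  convert h using 2
  · ext i j
    simp [Matrix.mul_apply, sub_eq_add_neg]
  · simp [dotProduct, sub_eq_add_neg]

lemma one_sub_of_const_mulVec {ι : Type*} [Fintype ι] [DecidableEq ι] (β s : ι → ℝ) (i : ι) :
    ((1 - Matrix.of fun i _ : ι => β i) *ᵥ s) i = s i - (∑ j, s j) * β i := by
  rw [sub_mulVec, one_mulVec, Pi.sub_apply, Finset.sum_mul]
  simp [mulVec, dotProduct, mul_comm]

variable {d : ℕ} {v : Fin (d + 1) → Fin d → ℤ} {β : Fin (d + 1) → ℝ}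

/-- `β` is the vector of barycentric coordinates of the origin with respect to the affinely
independent points `v`, it is positive, and no nonzero lattice point has positive barycentric
coordinates. -/
structure IsOriginWeight (v : Fin (d + 1) → Fin d → ℤ) (β : Fin (d + 1) → ℝ) : Prop where
  pos : ∀ i, 0 < β i
  sum_eq_one : ∑ i, β i = 1
  sum_smul : ∑ i, β i • toR (v i) = 0
  indep : ∀ t : Fin (d + 1) → ℝ, ∑ i, t i = 0 → ∑ i, t i • toR (v i) = 0 → t = 0
  eq_zero : ∀ (t : Fin (d + 1) → ℝ) (x : Fin d → ℤ), ∑ i, t i = 0 → (∀ i, 0 < β i + t i) →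
    ∑ i, t i • toR (v i) = toR x → t = 0

lemma IsCanonicalSimplex.exists_isOriginWeight (hv : IsCanonicalSimplex v) :
    ∃ β, IsOriginWeight v β := by
  obtain ⟨hind, h0, hx⟩ := hv
  let b : AffineBasis (Fin (d + 1)) ℝ (Fin d → ℝ) := ⟨fun i => toR (v i), hind, by
    rw [hind.affineSpan_eq_top_iff_card_eq_finrank_add_one]
    simp⟩
  have hint : interior (hullOf v) = {x | ∀ i, 0 < b.coord i x} := b.interior_convexHull
  have hcoord : ∀ w : Fin (d + 1) → ℝ, ∑ i, w i = 1 → ∀ i,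
      b.coord i (∑ i, w i • toR (v i)) = w i := fun w hw i => by
    have h := b.coord_apply_combination_of_mem (s := Finset.univ) (Finset.mem_univ i) hw
    rwa [Finset.univ.affineCombination_eq_linear_combination _ _ hw] at h
  have hsum : ∑ i, b.coord i 0 = 1 := b.sum_coord_apply_eq_one 0
  have hzero : ∑ i, b.coord i 0 • toR (v i) = 0 := b.linear_combination_coord_eq_self 0
  have hindep : ∀ t : Fin (d + 1) → ℝ, ∑ i, t i = 0 → ∑ i, t i • toR (v i) = 0 → t = 0 :=
    fun t ht hts => funext fun i =>
      affineIndependent_iff.1 hind Finset.univ t ht hts i (Finset.mem_univ i)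
  rw [hint] at h0
  refine ⟨fun i => b.coord i 0, h0, hsum, hzero, hindep, fun t x ht hpos htx => ?_⟩
  have hcomb : ∑ i, (b.coord i 0 + t i) • toR (v i) = toR x := by
    simp only [add_smul, Finset.sum_add_distrib, hzero, htx, zero_add]
  have hx0 : x = 0 := hx x <| by
    rw [hint]
    intro i
    rw [← hcomb, hcoord _ (by rw [Finset.sum_add_distrib, hsum, ht, add_zero])]
    exact hpos i
  refine hindep t ht ?_
  rw [htx, hx0]
  ext j
  simp [toR]

namespace IsOriginWeight

lemma comp_perm (h : IsOriginWeight v β) (σ : Equiv.Perm (Fin (d + 1))) :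
    IsOriginWeight (v ∘ σ) (β ∘ σ) where
  pos i := h.pos _
  sum_eq_one := (Equiv.sum_comp σ β).trans h.sum_eq_one
  sum_smul := (Equiv.sum_comp σ fun i => β i • toR (v i)).trans h.sum_smul
  indep t ht hts := by
    have := h.indep (t ∘ σ.symm) ((Equiv.sum_comp σ.symm t).trans ht) <| by
      rw [← hts, ← Equiv.sum_comp σ]
      simp
    ext i
    simpa using congrFun this (σ i)
  eq_zero t x ht hpos htx := by
    have := h.eq_zero (t ∘ σ.symm) x ((Equiv.sum_comp σ.symm t).trans ht)
      (fun i => by simpa using hpos (σ.symm i)) <| by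
      rw [← htx, ← Equiv.sum_comp σ]
      simp
    ext i
    simpa using congrFun this (σ i)

/-- The product-sum inequalities for the barycentric coordinates of the origin. -/
lemma prod_le_one_sub_sum (h : IsOriginWeight v β) {ι : Type*} [Fintype ι]
    {g : ι → Fin (d + 1)} (hg : Function.Injective g) {k : Fin (d + 1)} (hk : k ∉ Set.range g) :
    ∏ a, β (g a) ≤ 1 - ∑ a, β (g a) := by
  classical
  have hlt : ∑ a, β (g a) < 1 := by
    rw [← h.sum_eq_one, ← Finset.sum_image (s := Finset.univ) (f := β) hg.injOn]
    exact Finset.sum_lt_sum_of_subset (Finset.subset_univ _) (Finset.mem_univ k)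
      (by simpa using hk) (h.pos k) fun i _ _ => (h.pos i).le
  by_contra! hcon
  have hdet := det_one_sub_of_const fun a => β (g a)
  obtain ⟨z, hz0, hz⟩ := exists_int_ne_zero_abs_mulVec_lt
    (A := 1 - Matrix.of fun a _ => β (g a)) (c := fun a => β (g a))
    (by rw [hdet]; linarith) (fun a => h.pos _) (by
      rw [hdet, abs_of_pos (by linarith)]
      exact hcon)
  simp only [one_sub_of_const_mulVec] at hz
  wlog hσ : 0 ≤ ∑ a, (z a : ℝ) generalizing z with H
  · refine H (-z) (neg_ne_zero.2 hz0) (fun a => ?_) ?_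
    · rw [← abs_neg]
      simpa [sub_eq_add_neg, add_comm] using hz a
    · simp only [Pi.neg_apply, Int.cast_neg, Finset.sum_neg_distrib]
      linarith
  set σ := ∑ a, (z a : ℝ) with hσ_def
  let w : Fin (d + 1) → ℤ := fun i => ∑ a, if g a = i then z a else 0
  have hw : ∀ a, w (g a) = z a := fun a => by simp [w, hg.eq_iff]
  have hw' : ∀ i ∉ Set.range g, w i = 0 := fun i hi =>
    Finset.sum_eq_zero fun a _ => if_neg fun h => hi ⟨a, h⟩
  have hwsum : ∑ i, (w i : ℝ) = σ := by
    simp only [w, Int.cast_sum]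
    rw [Finset.sum_comm]
    simp [hσ_def]
  have ht := h.eq_zero (fun i => σ * β i - w i) (-∑ i, w i • v i)
    (by rw [Finset.sum_sub_distrib, ← Finset.mul_sum, h.sum_eq_one, hwsum, mul_one, sub_self])
    (fun i => by
      by_cases hi : i ∈ Set.range g
      · obtain ⟨a, rfl⟩ := hi
        rw [hw]
        linarith [(abs_lt.1 (hz a)).2]
      · rw [hw' i hi]
        have := h.pos i
        push_cast
        nlinarith)
    (by
      simp only [sub_smul, mul_smul, Finset.sum_sub_distrib, ← Finset.smul_sum, h.sum_smul]
      ext j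
      simp [toR, Finset.sum_apply])
  have hσ0 : σ = 0 := by
    have := congrFun ht k
    simpa [hw' k hk, (h.pos k).ne'] using this
  refine hz0 (funext fun a => ?_)
  have := congrFun ht (g a)
  simpa [hw, hσ0] using this

/-- Bound on the multiplicity in terms of the barycentric coordinates of the origin. -/
lemma mult_mul_prod_le (h : IsOriginWeight v β) :
    (mult v : ℝ) * ∏ i : Fin d, β i.castSucc ≤ β (Fin.last d) := by
  set V : Matrix (Fin d) (Fin d) ℤ := Matrix.of fun i j => v i.castSucc j with hV
  set W : Matrix (Fin d) (Fin d) ℝ := V.map (Int.cast : ℤ → ℝ) with hW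
  have hWdet : W.det = (V.det : ℝ) := (Int.cast_det V).symm
  have hlast : ∑ i : Fin d, β i.castSucc = 1 - β (Fin.last d) := by
    have := h.sum_eq_one
    rw [Fin.sum_univ_castSucc] at this
    linarith
  -- The coefficients with sum zero that represent the same point as `s ᵥ* W`.
  let T : (Fin d → ℝ) → Fin (d + 1) → ℝ := fun s =>
    Fin.snoc s 0 - (∑ i, s i) • β
  have hTsum : ∀ s, ∑ i, T s i = 0 := fun s => by
    simp only [T, Pi.sub_apply, Pi.smul_apply, Finset.sum_sub_distrib, smul_eq_mul,
      ← Finset.mul_sum, h.sum_eq_one]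
    simp [Fin.sum_univ_castSucc]
  have hTv : ∀ s, ∑ i, T s i • toR (v i) = s ᵥ* W := fun s => by
    simp only [T, Pi.sub_apply, Pi.smul_apply, sub_smul, Finset.sum_sub_distrib, smul_eq_mul,
      mul_smul, ← Finset.smul_sum, h.sum_smul]
    ext j
    simp [Fin.sum_univ_castSucc, vecMul, dotProduct, hW, hV, toR]
  have hTzero : ∀ s, T s = 0 → s = 0 := fun s hs => by
    have h1 : ∑ i, s i = 0 := by
      have := congrFun hs (Fin.last d)
      simpa [T, (h.pos _).ne'] using this
    ext i
    have := congrFun hs i.castSucc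
    simpa [T, h1] using this
  have hdet0 : W.det ≠ 0 := by
    intro hcon
    obtain ⟨s, hs0, hs⟩ := Matrix.exists_vecMul_eq_zero_iff.2 hcon
    exact hs0 (hTzero s (h.indep _ (hTsum s) ((hTv s).trans hs)))
  have hmult : (mult v : ℝ) ≤ |W.det| := by
    have hVdet : V.det ≠ 0 := by
      rw [hWdet] at hdet0
      exact_mod_cast hdet0
    have hli : LinearIndependent ℤ fun i : Fin d => v i.castSucc := by
      rw [Fintype.linearIndependent_iff]
      intro c hc
      have : c ᵥ* V = 0 := by
        rw [← hc]
        ext j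
        simp [vecMul, dotProduct, hV]
      exact congrFun (Matrix.eq_zero_of_vecMul_eq_zero hVdet this)
    let bN := Basis.span hli
    have hidx := AddSubgroup.index_eq_natAbs_det (Pi.basisFun ℤ (Fin d))
      (Submodule.span ℤ (Set.range fun i : Fin d => v i.castSucc)).toAddSubgroup bN
    have hdetV : (Pi.basisFun ℤ (Fin d)).det (fun i => (bN i : Fin d → ℤ)) = V.det := by
      rw [Basis.det_apply, ← Matrix.det_transpose]
      congr 1
      ext i j
      simp [bN, Basis.toMatrix_apply, hV, Basis.span_apply]
    have hle : (Submodule.span ℤ (Set.range fun i : Fin d => v i.castSucc)).toAddSubgroup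
        ≤ AddSubgroup.closure (Set.range v) := by
      rw [Submodule.span_int_eq_addSubgroupClosure]
      apply AddSubgroup.closure_mono
      rintro _ ⟨i, rfl⟩
      exact ⟨_, rfl⟩
    have hdvd := AddSubgroup.index_dvd_of_le hle
    rw [hidx, hdetV] at hdvd
    have hle' := Nat.le_of_dvd (Int.natAbs_pos.2 hVdet) hdvd
    rw [hWdet, ← Int.cast_abs, Int.abs_eq_natAbs]
    exact_mod_cast hle'
  have hprod : 0 < ∏ i : Fin d, β i.castSucc := Finset.prod_pos fun i _ => h.pos _
  refine (mul_le_mul_of_nonneg_right hmult hprod.le).trans ?_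
  by_contra! hcon
  set A := (1 - Matrix.of fun i _ : Fin d => β i.castSucc) * (Wᵀ)⁻¹ with hA
  have hAdet : A.det = β (Fin.last d) * W.det⁻¹ := by
    rw [hA, det_mul, det_one_sub_of_const fun i : Fin d => β i.castSucc, hlast,
      det_nonsing_inv, det_transpose, Ring.inverse_eq_inv']
    ring
  obtain ⟨x, hx0, hx⟩ := exists_int_ne_zero_abs_mulVec_lt (A := A)
    (c := fun i => β i.castSucc) (by
      rw [hAdet]
      exact mul_ne_zero (h.pos _).ne' (inv_ne_zero hdet0)) (fun i => h.pos _) (by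
      rw [hAdet, abs_mul, abs_inv, abs_of_pos (h.pos _), ← div_eq_mul_inv,
        div_lt_iff₀ (abs_pos.2 hdet0), mul_comm]
      exact hcon)
  have hs : ∀ x : Fin d → ℤ, ((Wᵀ)⁻¹ *ᵥ toR x) ᵥ* W = toR x := fun x => by
    rw [← mulVec_transpose, mulVec_mulVec, mul_nonsing_inv _ (by
      rw [det_transpose]; exact hdet0.isUnit), one_mulVec]
  simp only [hA, ← mulVec_mulVec, one_sub_of_const_mulVec] at hx
  change ∀ i : Fin d, |((Wᵀ)⁻¹ *ᵥ toR x) i - (∑ j, ((Wᵀ)⁻¹ *ᵥ toR x) j) * β i.castSucc|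
    < β i.castSucc at hx
  wlog hσ : ∑ j, ((Wᵀ)⁻¹ *ᵥ toR x) j ≤ 0 generalizing x with H
  · have hneg : toR (-x) = -toR x := by
      ext j
      simp [toR]
    refine H (-x) (neg_ne_zero.2 hx0) (fun i => ?_) ?_
    · rw [hneg, mulVec_neg, ← abs_neg]
      simpa [sub_eq_add_neg, add_comm] using hx i
    · rw [hneg, mulVec_neg]
      simp only [Pi.neg_apply, Finset.sum_neg_distrib]
      linarith
  have ht := h.eq_zero _ x (hTsum ((Wᵀ)⁻¹ *ᵥ toR x)) (fun i => by
    refine Fin.lastCases ?_ (fun i => ?_) i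
    · have := h.pos (Fin.last d)
      simp only [T, Pi.sub_apply, Fin.snoc_last, Pi.smul_apply, smul_eq_mul]
      nlinarith
    · simp only [T, Pi.sub_apply, Fin.snoc_castSucc, Pi.smul_apply, smul_eq_mul]
      linarith [(abs_lt.1 (hx i)).1]) ((hTv _).trans (hs x))
  have hx' := hs x
  rw [hTzero _ ht, zero_vecMul] at hx'
  refine hx0 (funext fun j => ?_)
  have := congrFun hx' j
  simpa [toR] using this.symm

lemma mult_le_of_antitone {n : ℕ} (hn : 3 ≤ n) {v : Fin (n + 2 + 1) → Fin (n + 2) → ℤ}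
    {β : Fin (n + 2 + 1) → ℝ} (h : IsOriginWeight v β) (hβ : Antitone β) :
    (mult v : ℝ) ≤ 3 * sylvPred n ^ 2 := by
  let x : ℕ → ℝ := fun i => if hi : i < n + 3 then β ⟨i, hi⟩ else 0
  have hx : ∀ i (hi : i < n + 3), x i = β ⟨i, hi⟩ := fun i hi => dif_pos hi
  have hpos : ∀ i < n + 3, 0 < x i := fun i hi => by
    rw [hx i hi]
    exact h.pos _
  have hanti : ∀ i j, i ≤ j → j < n + 3 → x j ≤ x i := fun i j hij hj => by
    rw [hx i (by omega), hx j hj]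
    exact hβ hij
  have hsum : ∑ i ∈ Finset.range (n + 3), x i = 1 := by
    rw [← h.sum_eq_one, ← Fin.sum_univ_eq_sum_range]
    exact Finset.sum_congr rfl fun i _ => hx i i.2
  have hps : ∀ j ≤ n, ∏ i ∈ Finset.range j, x i ≤ 1 - ∑ i ∈ Finset.range j, x i := by
    intro j hj
    rw [← Fin.sum_univ_eq_sum_range, ← Fin.prod_univ_eq_prod_range]
    convert h.prod_le_one_sub_sum (Fin.castLE_injective (by omega : j ≤ n + 2 + 1))
      (k := Fin.last _) (by
        rintro ⟨a, ha⟩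
        have := congrArg Fin.val ha
        simp at this
        omega) using 2
    · exact hx _ (by omega)
    · exact Finset.sum_congr rfl fun i _ => hx _ (by omega)
  have htail : ∀ k < n + 1, 1 - ∑ i ∈ Finset.range (k + 1), x i ≤ ((n + 2 - k : ℕ) : ℝ) * x k := by
    intro k hk
    rw [← hsum, ← Finset.sum_Ico_eq_sub _ (by omega : k + 1 ≤ n + 3)]
    refine (Finset.sum_le_card_nsmul _ _ (x k) fun i hi => ?_).trans_eq ?_
    · rw [Finset.mem_Ico] at hi
      exact hanti k i (by omega) hi.2
    · rw [Nat.card_Ico, nsmul_eq_mul, show n + 3 - (k + 1) = n + 2 - k by omega]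
  have hmain := one_div_le_prod hn (fun i hi => hpos i (by omega))
    (fun i hi => hanti i (i + 1) (by omega) (by omega)) hps (fun k hk => by
      have := htail k (by omega)
      rwa [show n + 2 - k = n - k + 2 by omega, Nat.cast_add, Nat.cast_ofNat] at this) n 0 rfl
  have hlast := htail n (by omega)
  rw [Finset.sum_range_succ, show n + 2 - n = 2 by omega] at hlast
  have hP : 0 < ∏ i ∈ Finset.range n, x i :=
    Finset.prod_pos fun i hi => hpos i (by simp at hi; omega)
  have hprod : 1 / (3 * sylvPred n ^ 2) ≤ ∏ i ∈ Finset.range (n + 1), x i := by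
    rw [Finset.prod_range_succ]
    refine hmain.trans (mul_le_mul_of_nonneg_left ?_ hP.le)
    norm_num at hlast ⊢
    linarith
  have hmult := h.mult_mul_prod_le
  have hcast : ∏ i : Fin (n + 2), β i.castSucc = ∏ i ∈ Finset.range (n + 2), x i := by
    rw [← Fin.prod_univ_eq_prod_range]
    exact Finset.prod_congr rfl fun i _ => (hx i (by omega)).symm
  have hle : β (Fin.last (n + 2)) ≤ x (n + 1) := by
    rw [hx _ (by omega)]
    exact hβ (Fin.le_last _)
  rw [hcast, Finset.prod_range_succ, ← mul_assoc] at hmult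
  have hone : (mult v : ℝ) * ∏ i ∈ Finset.range (n + 1), x i ≤ 1 :=
    le_of_mul_le_mul_right (by linarith) (hpos (n + 1) (by omega))
  have hs := sylvPred_pos n
  have := (mul_le_mul_of_nonneg_left hprod (Nat.cast_nonneg (mult v))).trans hone
  rwa [mul_one_div, div_le_one (by positivity)] at this

end IsOriginWeight

end Geometry

/-- Sharp multiplicity bound for `d`-dimensional canonical lattice simplices, `d ≥ 5`:
`mult P ≤ 3 (s_{d-1} - 1)^2`. -/
theorem mult_le_of_canonical {d : ℕ} (hd : 5 ≤ d) (v : Fin (d + 1) → Fin d → ℤ)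
    (hv : IsCanonicalSimplex v) :
    mult v ≤ 3 * (sylv (d - 2) - 1) ^ 2 := by
  obtain ⟨n, rfl⟩ : ∃ n, d = n + 2 := ⟨d - 2, by omega⟩
  obtain ⟨β, hβ⟩ := hv.exists_isOriginWeight
  let σ := Tuple.sort (-β)
  have hanti : Antitone (β ∘ σ) := fun i j hij => neg_le_neg_iff.1 (Tuple.monotone_sort (-β) hij)
  have h := (hβ.comp_perm σ).mult_le_of_antitone (by omega) hanti
  have hmult : mult (v ∘ σ) = mult v := by
    rw [mult, mult, σ.surjective.range_comp]
  have hs : ((sylv n - 1 : ℕ) : ℝ) = sylvPred n := by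
    rw [sylvPred, Nat.cast_sub (one_le_two.trans (two_le_sylv n)), Nat.cast_one]
  rw [hmult, ← hs] at h
  rw [Nat.add_sub_cancel]
  exact_mod_cast h
end

section
/- Let 1 ≤ d ≤ 3 and let P ⊂ ℝ^d be a d-dimensional canonical lattice simplex. Then mult(P) ≤ (d+1)^{d-1}, with equality if and only if P is unimodularly equivalent to conv{0, (d+1)e_1, …, (d+1)e_d} − (1, …, 1). -/
/-- Two subsets of `ℝ^d` are unimodularly equivalent if one is the image of the
other under `x ↦ A x + w` with `A ∈ GL_d(ℤ)` and `w ∈ ℤ^d`. -/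
def UnimodEquiv {d : ℕ} (Q Q' : Set (Fin d → ℝ)) : Prop :=
  ∃ (A : Matrix (Fin d) (Fin d) ℤ) (w : Fin d → ℤ), IsUnit A.det ∧
    Q' = (fun x => (A.map fun n : ℤ => (n : ℝ)).mulVec x + toR w) '' Q

/-- The vertex family of the simplex `conv{0, (d+1) e_1, …, (d+1) e_d} - (1,…,1)`. -/
def lowDimV (d : ℕ) : Fin (d + 1) → Fin d → ℤ := fun i j =>
  (if (j : ℕ) + 1 = (i : ℕ) then (d : ℤ) + 1 else 0) - 1

section

open Finset Matrix

theorem index_range_vecMulLinear {d : ℕ} (M : Matrix (Fin d) (Fin d) ℤ) (h : M.det ≠ 0) :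
    (LinearMap.range M.vecMulLinear).toAddSubgroup.index = M.det.natAbs := by
  have hinj : Function.Injective M.vecMulLinear := by
    rw [← LinearMap.ker_eq_bot, LinearMap.ker_eq_bot']
    intro c hc
    exact Matrix.eq_zero_of_vecMul_eq_zero h hc
  have := Submodule.natAbs_det_equiv (LinearMap.range M.vecMulLinear)
    (LinearEquiv.ofInjective _ hinj)
  have h2 : (LinearMap.range M.vecMulLinear).subtype ∘ₗ
      ((LinearEquiv.ofInjective _ hinj : _ ≃ₗ[ℤ] _) : _ →+ _).toIntLinearMap
        = Matrix.toLin' Mᵀ := by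
    ext1 i
    ext1
    simp [Matrix.vecMulLinear]
  rw [h2, LinearMap.det_toLin', Matrix.det_transpose] at this
  rw [this]
  rfl

theorem index_closure_range_row {d : ℕ} (M : Matrix (Fin d) (Fin d) ℤ) (h : M.det ≠ 0) :
    (AddSubgroup.closure (Set.range M)).index = M.det.natAbs := by
  rw [← index_range_vecMulLinear M h, range_vecMulLinear,
    Submodule.span_int_eq_addSubgroupClosure]
  rfl

theorem index_dvd_natAbs_det {d : ℕ} (N : AddSubgroup (Fin d → ℤ))
    (M : Matrix (Fin d) (Fin d) ℤ) (hM : ∀ i, M i ∈ N) : N.index ∣ M.det.natAbs := by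
  by_cases h : M.det = 0
  · simp [h]
  rw [← index_closure_range_row M h]
  apply AddSubgroup.index_dvd_of_le
  rw [AddSubgroup.closure_le]
  rintro _ ⟨i, rfl⟩
  exact hM i

/-- The matrix whose rows are the edges of the simplex at its first vertex. -/
def edgeMatrix {d : ℕ} (v : Fin (d + 1) → Fin d → ℤ) : Matrix (Fin d) (Fin d) ℤ :=
  Matrix.of fun i => v i.succ - v 0

theorem toR_smul_sum {d : ℕ} {ι : Type*} [Fintype ι] (c : ι → ℤ) (u : ι → Fin d → ℤ) :
    toR (∑ i, c i • u i) = ∑ i, (c i : ℝ) • toR (u i) := by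
  ext j
  simp [toR]

theorem vecMul_edgeMatrix {d : ℕ} (v : Fin (d + 1) → Fin d → ℤ) (c : Fin d → ℤ) :
    c ᵥ* edgeMatrix v = ∑ i, (Fin.cons (-∑ i, c i) c : Fin (d + 1) → ℤ) i • v i := by
  ext j
  simp [Fin.sum_univ_succ, edgeMatrix, Matrix.vecMul, dotProduct, mul_sub,
    Finset.sum_sub_distrib, Finset.sum_mul]
  ring

theorem det_edgeMatrix_ne_zero {d : ℕ} {v : Fin (d + 1) → Fin d → ℤ}
    (hv : AffineIndependent ℝ (fun i => toR (v i))) : (edgeMatrix v).det ≠ 0 := by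
  intro h
  obtain ⟨c, hc0, hc⟩ := Matrix.exists_vecMul_eq_zero_iff.mpr h
  rw [affineIndependent_iff] at hv
  rw [vecMul_edgeMatrix] at hc
  set w : Fin (d + 1) → ℤ := Fin.cons (-∑ i, c i) c with hw
  have := hv univ (fun i => (w i : ℝ)) (by simp [Fin.sum_univ_succ, hw])
    (by rw [← toR_smul_sum, hc]; ext; simp [toR])
  apply hc0
  ext i
  have := this i.succ (mem_univ _)
  simpa [hw] using this

/-- The affine basis formed by the vertices of a lattice simplex. -/
noncomputable def vertexBasis {d : ℕ} {v : Fin (d + 1) → Fin d → ℤ}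
    (hv : AffineIndependent ℝ (fun i => toR (v i))) : AffineBasis (Fin (d + 1)) ℝ (Fin d → ℝ) :=
  ⟨fun i => toR (v i), hv, by
    rw [hv.affineSpan_eq_top_iff_card_eq_finrank_add_one]; simp⟩

theorem vertexBasis_coord_sum {d : ℕ} {v : Fin (d + 1) → Fin d → ℤ}
    (hv : AffineIndependent ℝ (fun i => toR (v i))) {t : Fin (d + 1) → ℝ} (ht : ∑ i, t i = 1)
    (i : Fin (d + 1)) : (vertexBasis hv).coord i (∑ i, t i • toR (v i)) = t i := by
  have := (vertexBasis hv).coord_apply_combination_of_mem (mem_univ i) ht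
  rwa [Finset.affineCombination_eq_linear_combination _ _ _ ht] at this

theorem sum_vertexBasis_coord {d : ℕ} {v : Fin (d + 1) → Fin d → ℤ}
    (hv : AffineIndependent ℝ (fun i => toR (v i))) (x : Fin d → ℝ) :
    ∑ i, (vertexBasis hv).coord i x • toR (v i) = x :=
  (vertexBasis hv).linear_combination_coord_eq_self x

theorem interior_hullOf {d : ℕ} {v : Fin (d + 1) → Fin d → ℤ}
    (hv : AffineIndependent ℝ (fun i => toR (v i))) :
    interior (hullOf v) = {x | ∀ i, 0 < (vertexBasis hv).coord i x} :=
  (vertexBasis hv).interior_convexHull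

/-- A lattice point with positive barycentric coordinates is the origin. -/
theorem IsCanonicalSimplex.eq_zero {d : ℕ} {v : Fin (d + 1) → Fin d → ℤ}
    (hv : IsCanonicalSimplex v) {t : Fin (d + 1) → ℝ} (ht : ∀ i, 0 < t i) (ht1 : ∑ i, t i = 1)
    {x : Fin d → ℤ} (hx : ∑ i, t i • toR (v i) = toR x) : x = 0 := by
  apply hv.2.2
  rw [interior_hullOf hv.1, ← hx]
  intro i
  rw [vertexBasis_coord_sum hv.1 ht1]
  exact ht i

theorem eq_of_sum_smul_eq {d : ℕ} {v : Fin (d + 1) → Fin d → ℤ}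
    (hv : AffineIndependent ℝ (fun i => toR (v i))) {s t : Fin (d + 1) → ℝ} (hs : ∑ i, s i = 1)
    (ht : ∑ i, t i = 1) (hst : ∑ i, s i • toR (v i) = ∑ i, t i • toR (v i)) : s = t := by
  ext i
  rw [← vertexBasis_coord_sum hv hs, hst, vertexBasis_coord_sum hv ht]

theorem IsCanonicalSimplex.exists_barycentric {d : ℕ} {v : Fin (d + 1) → Fin d → ℤ}
    (hv : IsCanonicalSimplex v) :
    ∃ t : Fin (d + 1) → ℝ, (∀ i, 0 < t i) ∧ ∑ i, t i = 1 ∧ ∑ i, t i • toR (v i) = 0 := by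
  have h := hv.2.1
  rw [interior_hullOf hv.1] at h
  exact ⟨_, h, (vertexBasis hv.1).sum_coord_apply_eq_one 0, sum_vertexBasis_coord hv.1 0⟩

theorem sum_cons_div_smul {d : ℕ} {v : Fin (d + 1) → Fin d → ℤ} {c x : Fin d → ℤ} {D : ℤ}
    (hD : D ≠ 0) (h : c ᵥ* edgeMatrix v = D • x) :
    ∑ i, (((Fin.cons (-∑ i, c i) c : Fin (d + 1) → ℤ) i : ℝ) / D) • toR (v i) = toR x := by
  have hD' : (D : ℝ) ≠ 0 := by exact_mod_cast hD
  rw [vecMul_edgeMatrix] at h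
  have h2 := congrArg toR h
  rw [toR_smul_sum] at h2
  have h3 : toR x = (D : ℝ)⁻¹ • toR (D • x) := by
    ext j
    simp [toR, hD']
  rw [h3, ← h2, Finset.smul_sum]
  refine Finset.sum_congr rfl fun i _ => ?_
  rw [smul_smul, div_eq_inv_mul]

theorem sum_cons_div {d : ℕ} (c : Fin d → ℤ) (D : ℤ) :
    ∑ i, ((Fin.cons (-∑ i, c i) c : Fin (d + 1) → ℤ) i : ℝ) / D = 0 := by
  rw [← Finset.sum_div, Fin.sum_univ_succ]
  simp

/-- The barycentric coordinates of the origin, scaled by the normalized volume, are positive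
integers divisible by the multiplicity. -/
theorem exists_integral_weights {d : ℕ} {v : Fin (d + 1) → Fin d → ℤ}
    (hv : AffineIndependent ℝ (fun i => toR (v i))) {t : Fin (d + 1) → ℝ} (ht : ∀ i, 0 < t i)
    (ht1 : ∑ i, t i = 1) (ht0 : ∑ i, t i • toR (v i) = 0) :
    ∃ b : Fin (d + 1) → ℕ, (∀ i, (b i : ℝ) = (edgeMatrix v).det.natAbs * t i) ∧
      ∀ i, mult v ∣ b i := by
  set W := edgeMatrix v with hW
  have hδ : W.det ≠ 0 := det_edgeMatrix_ne_zero hv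
  have hδ' : (W.det : ℝ) ≠ 0 := by exact_mod_cast hδ
  set c : Fin d → ℤ := (-v 0) ᵥ* W.adjugate with hc
  have hcW : c ᵥ* W = W.det • (-v 0) := by
    rw [hc, Matrix.vecMul_vecMul, Matrix.adjugate_mul, Matrix.vecMul_smul, Matrix.vecMul_one]
  set w : Fin (d + 1) → ℤ := Fin.cons (-∑ i, c i) c with hw
  have key : (fun i => (w i : ℝ) / W.det + (Pi.single 0 1 : Fin (d + 1) → ℝ) i) = t := by
    apply eq_of_sum_smul_eq hv _ ht1
    · rw [ht0]
      simp only [add_smul, Finset.sum_add_distrib]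
      rw [sum_cons_div_smul hδ hcW]
      ext j
      simp [toR, Pi.single_apply, ite_smul]
    · rw [Finset.sum_add_distrib, sum_cons_div]
      simp
  have hg : ∀ i, ((w i + (Pi.single 0 W.det : Fin (d + 1) → ℤ) i : ℤ) : ℝ) = W.det * t i := by
    intro i
    rw [← key]
    refine Fin.cases ?_ (fun i => ?_) i
    · simp
      field_simp
    · simp
      field_simp
  refine ⟨fun i => (w i + (Pi.single 0 W.det : Fin (d + 1) → ℤ) i).natAbs, fun i => ?_,
    fun i => ?_⟩
  · rw [Nat.cast_natAbs, Int.cast_abs, hg, abs_mul, abs_of_pos (ht i), Nat.cast_natAbs,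
      Int.cast_abs]
  · have hN : ∀ i, v i ∈ AddSubgroup.closure (Set.range v) := fun i =>
      AddSubgroup.subset_closure ⟨i, rfl⟩
    have hWN : ∀ i, W i ∈ AddSubgroup.closure (Set.range v) := fun i =>
      sub_mem (hN _) (hN _)
    have hci : ∀ i, (mult v : ℤ) ∣ c i := by
      intro i
      have : c i = (W.updateRow i (-v 0)).det := by
        rw [← Matrix.cramer_transpose_apply, Matrix.cramer_eq_adjugate_mulVec,
          ← Matrix.adjugate_transpose, Matrix.mulVec_transpose]
      rw [this, Int.natCast_dvd]
      apply index_dvd_natAbs_det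
      intro k
      by_cases hk : k = i
      · subst hk
        rw [Matrix.updateRow_self]
        exact neg_mem (hN 0)
      · rw [Matrix.updateRow_ne hk]
        exact hWN k
    rw [← Int.natCast_dvd]
    refine Fin.cases ?_ (fun i => ?_) i
    · simp only [hw, Fin.cons_zero, Pi.single_eq_same]
      refine dvd_add ((Finset.dvd_sum fun i _ => hci i).neg_right) ?_
      rw [Int.natCast_dvd]
      exact index_dvd_natAbs_det _ _ hWN
    · simpa [hw] using hci i

/-- The canonical property in edge coordinates. -/
theorem IsCanonicalSimplex.edge_coord_eq_zero {d : ℕ} {v : Fin (d + 1) → Fin d → ℤ}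
    (hv : IsCanonicalSimplex v) {t : Fin (d + 1) → ℝ}
    (ht1 : ∑ i, t i = 1) (ht0 : ∑ i, t i • toR (v i) = 0) {b : Fin (d + 1) → ℕ}
    (hb : ∀ i, (b i : ℝ) = (edgeMatrix v).det.natAbs * t i) {c x : Fin d → ℤ}
    (hc : c ᵥ* edgeMatrix v = ((edgeMatrix v).det.natAbs : ℤ) • x)
    (hpos : ∀ i, -(b i.succ : ℤ) < c i) (hsum : ∑ i, c i < b 0) : c = 0 := by
  have hδ := det_edgeMatrix_ne_zero hv.1
  set D := (edgeMatrix v).det.natAbs with hD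
  have hD0 : 0 < D := by rw [hD]; omega
  have hDR : (0 : ℝ) < D := by exact_mod_cast hD0
  have hx : x = 0 := by
    refine hv.eq_zero (t := fun i =>
      ((Fin.cons (-∑ i, c i) c : Fin (d + 1) → ℤ) i : ℝ) / (D : ℤ) + t i) ?_ ?_ ?_
    · intro i
      have : t i = b i / D := by rw [hb]; field_simp
      rw [this, Int.cast_natCast, ← add_div]
      apply div_pos _ hDR
      refine Fin.cases ?_ (fun i => ?_) i
      · simp only [Fin.cons_zero]
        have : (0 : ℤ) < -∑ i, c i + b 0 := by omega
        exact_mod_cast this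
      · simp only [Fin.cons_succ]
        have : (0 : ℤ) < c i + b i.succ := by linarith [hpos i]
        exact_mod_cast this
    · rw [Finset.sum_add_distrib, sum_cons_div, ht1, zero_add]
    · simp only [add_smul, Finset.sum_add_distrib]
      rw [sum_cons_div_smul (by omega) hc, ht0, add_zero]
  rw [hx, smul_zero] at hc
  exact Matrix.eq_zero_of_vecMul_eq_zero hδ hc

theorem IsCanonicalSimplex.barycentric_le_half {d : ℕ} (hd : 1 ≤ d) {v : Fin (d + 1) → Fin d → ℤ}
    (hv : IsCanonicalSimplex v) {t : Fin (d + 1) → ℝ} (ht : ∀ i, 0 < t i)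
    (ht1 : ∑ i, t i = 1) (ht0 : ∑ i, t i • toR (v i) = 0) (i : Fin (d + 1)) : t i ≤ 1 / 2 := by
  by_contra! h
  have hneg : -v i = 0 := by
    refine hv.eq_zero (t := fun j => 2 * t j - (Pi.single i 1 : Fin (d + 1) → ℝ) j) ?_ ?_ ?_
    · intro j
      by_cases hj : j = i
      · subst hj
        rw [Pi.single_eq_same]
        linarith
      · rw [Pi.single_eq_of_ne hj]
        linarith [ht j]
    · rw [Finset.sum_sub_distrib, ← Finset.mul_sum, ht1]
      simp
      norm_num
    · simp only [sub_smul, Finset.sum_sub_distrib, mul_smul]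
      rw [← Finset.smul_sum, ht0]
      ext j
      simp [toR, Pi.single_apply, ite_smul]
  have hvi : v i = 0 := neg_eq_zero.mp hneg
  have hs : (Pi.single i 1 : Fin (d + 1) → ℝ) = t := by
    apply eq_of_sum_smul_eq hv.1 (by simp) ht1
    rw [ht0]
    simp only [Pi.single_apply, ite_smul, one_smul, zero_smul, Finset.sum_ite_eq', mem_univ,
      if_true, hvi]
    ext j
    simp [toR]
  have : Nontrivial (Fin (d + 1)) := Fin.nontrivial_iff_two_le.mpr (by omega)
  obtain ⟨j, hj⟩ := exists_ne i
  have := ht j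
  rw [← hs, Pi.single_eq_of_ne hj] at this
  exact lt_irrefl _ this

theorem exists_of_mem_range_adjugate {d : ℕ} (W : Matrix (Fin d) (Fin d) ℤ) {c : Fin d → ℤ}
    (hc : c ∈ LinearMap.range W.adjugate.vecMulLinear) :
    ∃ x, c ᵥ* W = (W.det.natAbs : ℤ) • x := by
  obtain ⟨y, rfl⟩ := hc
  have h : W.adjugate.vecMulLinear y ᵥ* W = W.det • y := by
    rw [Matrix.vecMulLinear_apply, Matrix.vecMul_vecMul, Matrix.adjugate_mul, Matrix.vecMul_smul,
      Matrix.vecMul_one]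
  rw [h]
  rcases Int.natAbs_eq W.det with h | h
  · exact ⟨y, by rw [← h]⟩
  · refine ⟨-y, ?_⟩
    conv_lhs => rw [h]
    simp

/-- The map from a box of edge coordinates to the group of edge coordinates modulo the
coordinates of lattice points. -/
def boxMap {d : ℕ} (W : Matrix (Fin d) (Fin d) ℤ) (b : Fin d → ℕ) (k : ∀ i, Fin (b i)) :
    (Fin d → ℤ) ⧸ (LinearMap.range W.adjugate.vecMulLinear).toAddSubgroup :=
  QuotientAddGroup.mk fun i => ((k i : ℕ) : ℤ)

theorem card_quotient_adjugate {d : ℕ} {W : Matrix (Fin d) (Fin d) ℤ} (hW : W.det ≠ 0) :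
    Nat.card ((Fin d → ℤ) ⧸ (LinearMap.range W.adjugate.vecMulLinear).toAddSubgroup) =
      W.det.natAbs ^ (d - 1) := by
  have h := index_range_vecMulLinear W.adjugate
  rw [Matrix.det_adjugate, Fintype.card_fin, Int.natAbs_pow] at h
  exact h (pow_ne_zero _ hW)

theorem IsCanonicalSimplex.boxMap_injective {d : ℕ} {v : Fin (d + 1) → Fin d → ℤ}
    (hv : IsCanonicalSimplex v) {t : Fin (d + 1) → ℝ} (ht : ∀ i, 0 < t i)
    (ht1 : ∑ i, t i = 1) (ht0 : ∑ i, t i • toR (v i) = 0) {b : Fin (d + 1) → ℕ}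
    (hb : ∀ i, (b i : ℝ) = (edgeMatrix v).det.natAbs * t i) :
    Function.Injective (boxMap (edgeMatrix v) fun i => b i.succ) := by
  have hD0 : 0 < (edgeMatrix v).det.natAbs := by
    have := det_edgeMatrix_ne_zero hv.1
    omega
  have hb0 : 0 < b 0 := by
    have : (0 : ℝ) < b 0 := by rw [hb]; exact mul_pos (by exact_mod_cast hD0) (ht 0)
    exact_mod_cast this
  have aux : ∀ k l : ∀ i : Fin d, Fin (b i.succ),
      (fun i => ((l i : ℕ) : ℤ) - (k i : ℕ)) ∈ LinearMap.range (edgeMatrix v).adjugate.vecMulLinear →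
      ∑ i, (((l i : ℕ) : ℤ) - (k i : ℕ)) ≤ 0 → k = l := by
    intro k l hkl hs
    obtain ⟨x, hx⟩ := exists_of_mem_range_adjugate _ hkl
    have := hv.edge_coord_eq_zero ht1 ht0 hb hx (fun i => by have := (k i).2; omega) (by omega)
    ext i
    have := congrFun this i
    simp only [Pi.zero_apply] at this
    omega
  intro k l hkl
  rw [boxMap, boxMap, QuotientAddGroup.eq] at hkl
  have hkl' : (fun i => ((l i : ℕ) : ℤ) - (k i : ℕ)) ∈
      LinearMap.range (edgeMatrix v).adjugate.vecMulLinear := by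
    convert! hkl using 1
    ext i
    simp
    ring
  rcases le_total (∑ i, (((l i : ℕ) : ℤ) - (k i : ℕ))) 0 with h | h
  · exact aux k l hkl' h
  · refine (aux l k ?_ ?_).symm
    · convert! neg_mem hkl' using 1
      ext i
      simp
    · simp only [Finset.sum_sub_distrib] at h ⊢
      omega

/-- The volume estimate for canonical simplices. -/
theorem IsCanonicalSimplex.prod_weights_le {d : ℕ} {v : Fin (d + 1) → Fin d → ℤ}
    (hv : IsCanonicalSimplex v) {t : Fin (d + 1) → ℝ} (ht : ∀ i, 0 < t i)
    (ht1 : ∑ i, t i = 1) (ht0 : ∑ i, t i • toR (v i) = 0) {b : Fin (d + 1) → ℕ}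
    (hb : ∀ i, (b i : ℝ) = (edgeMatrix v).det.natAbs * t i) :
    ∏ i : Fin d, b i.succ ≤ (edgeMatrix v).det.natAbs ^ (d - 1) := by
  have hδ := det_edgeMatrix_ne_zero hv.1
  have hcard := card_quotient_adjugate hδ
  have : Finite ((Fin d → ℤ) ⧸
      (LinearMap.range (edgeMatrix v).adjugate.vecMulLinear).toAddSubgroup) :=
    Nat.finite_of_card_ne_zero (by rw [hcard]; exact pow_ne_zero _ (by omega))
  have h := Nat.card_le_card_of_injective _ (hv.boxMap_injective ht ht1 ht0 hb)
  rw [hcard] at h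
  simpa using h

theorem toR_injective {d : ℕ} : Function.Injective (toR : (Fin d → ℤ) → Fin d → ℝ) := by
  intro x y h
  ext j
  have := congrFun h j
  simpa [toR] using this

/-- The affine map of `ℝ^d` given by an integer matrix and an integer translation. -/
def latticeAffineMap {d : ℕ} (A : Matrix (Fin d) (Fin d) ℤ) (w : Fin d → ℤ) :
    (Fin d → ℝ) →ᵃ[ℝ] (Fin d → ℝ) :=
  (Matrix.toLin' (A.map fun n : ℤ => (n : ℝ))).toAffineMap + AffineMap.const ℝ _ (toR w)

theorem latticeAffineMap_coe {d : ℕ} (A : Matrix (Fin d) (Fin d) ℤ) (w : Fin d → ℤ) :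
    ⇑(latticeAffineMap A w) =
      fun x => (A.map fun n : ℤ => (n : ℝ)).mulVec x + toR w := by
  ext x
  simp [latticeAffineMap]

theorem latticeAffineMap_toR {d : ℕ} (A : Matrix (Fin d) (Fin d) ℤ) (w x : Fin d → ℤ) :
    latticeAffineMap A w (toR x) = toR (A *ᵥ x + w) := by
  rw [latticeAffineMap_coe]
  ext j
  simp [toR, Matrix.mulVec, dotProduct]

theorem latticeAffineMap_injective {d : ℕ} {A : Matrix (Fin d) (Fin d) ℤ} (hA : IsUnit A.det)
    (w : Fin d → ℤ) : Function.Injective (latticeAffineMap A w) := by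
  have hdet : IsUnit (A.map fun n : ℤ => (n : ℝ)).det := by
    have := hA.map (Int.castRingHom ℝ)
    rwa [RingHom.map_det] at this
  rw [latticeAffineMap_coe]
  intro x y h
  exact Matrix.mulVec_injective_iff_isUnit.mpr ((Matrix.isUnit_iff_isUnit_det _).mpr hdet)
    (add_right_cancel h)

theorem image_latticeAffineMap_hullOf {d : ℕ} (A : Matrix (Fin d) (Fin d) ℤ) (w : Fin d → ℤ)
    (v : Fin (d + 1) → Fin d → ℤ) :
    latticeAffineMap A w '' hullOf v = hullOf fun i => A *ᵥ v i + w := by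
  rw [hullOf, AffineMap.image_convexHull, ← Set.range_comp, hullOf]
  congr 2
  ext1 i
  exact latticeAffineMap_toR A w (v i)

theorem toR_mem_extremePoints {d : ℕ} {v : Fin (d + 1) → Fin d → ℤ}
    (hv : AffineIndependent ℝ (fun i => toR (v i))) (i : Fin (d + 1)) :
    toR (v i) ∈ (hullOf v).extremePoints ℝ := by
  have hhull : hullOf v = {x | ∀ i, 0 ≤ (vertexBasis hv).coord i x} :=
    (vertexBasis hv).convexHull_eq_nonneg_coord
  rw [mem_extremePoints_iff_left]
  refine ⟨subset_convexHull ℝ _ ⟨i, rfl⟩, ?_⟩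
  rw [hhull]
  rintro x hx y hy ⟨a, b, ha, hb, hab, hxy⟩
  have hz : ∀ j, j ≠ i → (vertexBasis hv).coord j x = 0 := by
    intro j hj
    have h := Convex.combo_affine_apply (f := (vertexBasis hv).coord j) (x := x) (y := y) hab
    rw [hxy] at h
    have h0 : (vertexBasis hv).coord j (toR (v i)) = 0 :=
      (vertexBasis hv).coord_apply_ne hj
    rw [h0] at h
    simp only [smul_eq_mul] at h
    have h1 := mul_nonneg ha.le (hx j)
    have h2 := mul_nonneg hb.le (hy j)
    have h3 : a * (vertexBasis hv).coord j x = 0 := by linarith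
    exact (mul_eq_zero.mp h3).resolve_left ha.ne'
  have h1 := (vertexBasis hv).sum_coord_apply_eq_one x
  rw [Finset.sum_eq_single i (fun j _ hj => hz j hj) (by simp)] at h1
  have h2 := sum_vertexBasis_coord hv x
  rw [Finset.sum_eq_single i (fun j _ hj => by rw [hz j hj, zero_smul]) (by simp), h1,
    one_smul] at h2
  exact h2.symm

theorem sum_lowDimV (d : ℕ) : ∑ i, lowDimV d i = 0 := by
  ext j
  simp only [Finset.sum_apply, lowDimV, Fin.sum_univ_succ, Fin.val_zero, Fin.val_succ,
    Finset.sum_sub_distrib, Nat.succ_ne_zero, if_false, add_left_inj, Fin.val_inj]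
  simp
  ring

theorem mult_lowDimV {d : ℕ} (hd1 : 1 ≤ d) (hd3 : d ≤ 3) :
    mult (lowDimV d) = (d + 1) ^ (d - 1) := by
  set M : Matrix (Fin d) (Fin d) ℤ := Matrix.of fun i j => lowDimV d i.succ j with hM
  have hdet : M.det.natAbs = (d + 1) ^ (d - 1) := by
    rw [hM]
    interval_cases d
    · decide
    · decide
    · decide
  rw [← hdet, ← index_closure_range_row M (by
    intro h
    rw [h] at hdet
    exact pow_ne_zero _ (Nat.succ_ne_zero d) hdet.symm), mult]
  congr 1
  apply le_antisymm
  · rw [AddSubgroup.closure_le]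
    rintro _ ⟨i, rfl⟩
    have hs : ∀ i : Fin d, lowDimV d i.succ ∈ AddSubgroup.closure (Set.range M) := fun i =>
      AddSubgroup.subset_closure ⟨i, rfl⟩
    refine Fin.cases ?_ (fun i => hs i) i
    have h := sum_lowDimV d
    rw [Fin.sum_univ_succ] at h
    rw [eq_neg_of_add_eq_zero_left h]
    exact neg_mem (sum_mem fun i _ => hs i)
  · apply AddSubgroup.closure_mono
    rintro _ ⟨i, rfl⟩
    exact ⟨i.succ, rfl⟩

theorem mult_mulVec {d : ℕ} {A : Matrix (Fin d) (Fin d) ℤ} (hA : IsUnit A.det)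
    (v : Fin (d + 1) → Fin d → ℤ) : mult (fun i => A *ᵥ v i) = mult v := by
  let e : (Fin d → ℤ) ≃+ (Fin d → ℤ) :=
    { toFun := fun x => A *ᵥ x
      invFun := fun x => A⁻¹ *ᵥ x
      left_inv := fun x => by
        simp [Matrix.mulVec_mulVec, Matrix.nonsing_inv_mul _ hA]
      right_inv := fun x => by
        simp [Matrix.mulVec_mulVec, Matrix.mul_nonsing_inv _ hA]
      map_add' := Matrix.mulVec_add A }
  rw [mult, mult, ← AddSubgroup.index_map_equiv (AddSubgroup.closure (Set.range v)) e,
    AddMonoidHom.map_closure, ← Set.range_comp]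
  rfl

/-- A canonical simplex equivalent to the model simplex has the same multiplicity. -/
theorem IsCanonicalSimplex.mult_eq_of_unimodEquiv {d : ℕ} {v : Fin (d + 1) → Fin d → ℤ}
    (hv : IsCanonicalSimplex v) (h : UnimodEquiv (hullOf v) (hullOf (lowDimV d))) :
    mult v = mult (lowDimV d) := by
  obtain ⟨A, w, hA, hAw⟩ := h
  rw [← latticeAffineMap_coe, image_latticeAffineMap_hullOf] at hAw
  have hind : AffineIndependent ℝ fun i => toR (A *ᵥ v i + w) := by
    have := hv.1.map' _ (latticeAffineMap_injective hA w)
    simpa only [Function.comp_def, latticeAffineMap_toR] using this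
  have hex : ∀ i, ∃ j, lowDimV d j = A *ᵥ v i + w := by
    intro i
    have h1 := toR_mem_extremePoints hind i
    rw [← hAw] at h1
    obtain ⟨j, hj⟩ := extremePoints_convexHull_subset h1
    exact ⟨j, toR_injective hj⟩
  choose σ hσ using hex
  have hσinj : Function.Injective σ := by
    intro i j hij
    apply hind.injective
    simp only [← hσ, hij]
  have hσbij := Finite.injective_iff_bijective.mp hσinj
  have hAinv : ∀ x, A *ᵥ (A⁻¹ *ᵥ x) = x := fun x => by
    rw [Matrix.mulVec_mulVec, Matrix.mul_nonsing_inv _ hA, Matrix.one_mulVec]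
  have hinvA : ∀ x, A⁻¹ *ᵥ (A *ᵥ x) = x := fun x => by
    rw [Matrix.mulVec_mulVec, Matrix.nonsing_inv_mul _ hA, Matrix.one_mulVec]
  have hsum : ∑ i, v i = ((d : ℤ) + 1) • (A⁻¹ *ᵥ (-w)) := by
    have h1 := hσbij.sum_comp (lowDimV d)
    rw [sum_lowDimV] at h1
    simp only [hσ, Finset.sum_add_distrib, ← Matrix.mulVec_sum] at h1
    rw [← hinvA (∑ i, v i), eq_neg_of_add_eq_zero_left h1, ← Matrix.mulVec_smul]
    simp
  have hz : A⁻¹ *ᵥ (-w) = 0 := by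
    have hd : (d : ℝ) + 1 ≠ 0 := by positivity
    refine hv.eq_zero (t := fun _ => 1 / ((d : ℝ) + 1)) (fun _ => by positivity)
      (by simp [hd]) ?_
    rw [← Finset.smul_sum]
    ext j
    have := congrArg (fun x : ℤ => (x : ℝ)) (congrFun hsum j)
    simp only [Finset.sum_apply, Pi.smul_apply, smul_eq_mul] at this ⊢
    push_cast at this
    simp only [toR]
    rw [this]
    field_simp
  have hw : w = 0 := by
    have := hAinv (-w)
    rw [hz, Matrix.mulVec_zero] at this
    simpa using this.symm
  rw [← mult_mulVec hA, mult, mult, ← hσbij.surjective.range_comp (lowDimV d)]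
  congr 3
  ext1 i
  rw [Function.comp_apply, hσ, hw, add_zero]

theorem unimodEquiv_of_transpose_mulVec {d : ℕ} {U : Matrix (Fin d) (Fin d) ℤ}
    (hU : IsUnit U.det) {v v' : Fin (d + 1) → Fin d → ℤ} (h : ∀ i, U *ᵥ v' i = v i) :
    UnimodEquiv (hullOf v) (hullOf v') := by
  refine ⟨U⁻¹, 0, Matrix.isUnit_nonsing_inv_det U hU, ?_⟩
  rw [← latticeAffineMap_coe, image_latticeAffineMap_hullOf]
  congr
  ext1 i
  rw [← h i, Matrix.mulVec_mulVec, Matrix.nonsing_inv_mul _ hU, Matrix.one_mulVec, add_zero]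

/-- In the extremal case, every edge at the first vertex is divisible by `d + 1`. -/
theorem IsCanonicalSimplex.edge_eq_smul {d m : ℕ} {v : Fin (d + 1) → Fin d → ℤ}
    (hv : IsCanonicalSimplex v) (hd : 1 ≤ d) {t : Fin (d + 1) → ℝ} (ht : ∀ i, 0 < t i)
    (ht1 : ∑ i, t i = 1) (ht0 : ∑ i, t i • toR (v i) = 0)
    (hb : ∀ i, (m : ℝ) = (edgeMatrix v).det.natAbs * t i) (hm : m = (d + 1) ^ (d - 1))
    (hD : (edgeMatrix v).det.natAbs = (d + 1) * m) (i : Fin d) :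
    ∃ u, edgeMatrix v i = ((d : ℤ) + 1) • u := by
  have hδ := det_edgeMatrix_ne_zero hv.1
  have hcard := card_quotient_adjugate hδ
  have hm0 : 0 < m := by rw [hm]; positivity
  have hfin : Finite ((Fin d → ℤ) ⧸
      (LinearMap.range (edgeMatrix v).adjugate.vecMulLinear).toAddSubgroup) :=
    Nat.finite_of_card_ne_zero (by rw [hcard]; exact pow_ne_zero _ (by omega))
  have hinj := hv.boxMap_injective ht ht1 ht0 (b := fun _ => m) hb
  have hbij := hinj.bijective_of_nat_card_le (by
    rw [hcard, hD, mul_pow, ← hm, Nat.card_eq_fintype_card, Fintype.card_pi]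
    simp only [Fintype.card_fin, Finset.prod_const, Finset.card_univ]
    rw [← pow_succ', Nat.sub_add_cancel hd])
  obtain ⟨k, hk⟩ := hbij.surjective (QuotientAddGroup.mk (Pi.single i (m : ℤ)))
  rw [boxMap, QuotientAddGroup.eq] at hk
  obtain ⟨x, hx⟩ := exists_of_mem_range_adjugate _ hk
  set c : Fin d → ℤ := -(fun i => ((k i : ℕ) : ℤ)) + Pi.single i (m : ℤ) with hc
  have hci : ∀ j, c j = -(k j : ℕ) + (Pi.single i (m : ℤ) : Fin d → ℤ) j := fun j => rfl
  have hge : (m : ℤ) ≤ ∑ j, c j := by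
    by_contra! hlt
    have h0 := hv.edge_coord_eq_zero ht1 ht0 (b := fun _ => m) hb hx (fun j => by
      rw [hci]
      have h1 := (k j).2
      have h2 : (0 : ℤ) ≤ (Pi.single i (m : ℤ) : Fin d → ℤ) j := by
        rw [Pi.single_apply]
        split_ifs <;> omega
      omega) hlt
    have h3 := congrFun h0 i
    rw [hci, Pi.single_eq_same, Pi.zero_apply] at h3
    have := (k i).2
    omega
  have hk0 : ∀ j, ((k j : ℕ) : ℤ) = 0 := by
    simp only [hci, Finset.sum_add_distrib, Finset.sum_neg_distrib, Finset.sum_pi_single',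
      mem_univ, if_true] at hge
    have h4 : ∑ j, ((k j : ℕ) : ℤ) = 0 :=
      le_antisymm (by linarith) (Finset.sum_nonneg fun j _ => by positivity)
    intro j
    exact (Finset.sum_eq_zero_iff_of_nonneg fun j _ => by positivity).mp h4 j (mem_univ j)
  have hcs : c = Pi.single i (m : ℤ) := by
    ext j
    rw [hci, hk0]
    simp
  refine ⟨x, ?_⟩
  rw [hcs, hD] at hx
  ext j
  have h5 := congrFun hx j
  simp only [Matrix.single_vecMul, Pi.smul_apply, smul_eq_mul] at h5 ⊢
  push_cast at h5
  have hm0' : (m : ℤ) ≠ 0 := by omega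
  apply mul_left_cancel₀ hm0'
  simp only [Matrix.row] at h5
  linarith

theorem IsCanonicalSimplex.unimodEquiv_of_weights_eq {d m : ℕ} {v : Fin (d + 1) → Fin d → ℤ}
    (hv : IsCanonicalSimplex v) (hd : 1 ≤ d) {t : Fin (d + 1) → ℝ} (ht : ∀ i, 0 < t i)
    (ht1 : ∑ i, t i = 1) (ht0 : ∑ i, t i • toR (v i) = 0)
    (hb : ∀ i, (m : ℝ) = (edgeMatrix v).det.natAbs * t i) (hm : m = (d + 1) ^ (d - 1)) :
    UnimodEquiv (hullOf v) (hullOf (lowDimV d)) := by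
  have hD : (edgeMatrix v).det.natAbs = (d + 1) * m := by
    have h1 : ∑ i : Fin (d + 1), (m : ℝ) = (edgeMatrix v).det.natAbs := by
      rw [Finset.sum_congr rfl fun i _ => hb i, ← Finset.mul_sum, ht1, mul_one]
    rw [Finset.sum_const, Finset.card_univ, Fintype.card_fin, nsmul_eq_mul] at h1
    exact_mod_cast h1.symm
  have hm0 : 0 < m := by rw [hm]; positivity
  choose u hu using hv.edge_eq_smul hd ht ht1 ht0 hb hm hD
  set U : Matrix (Fin d) (Fin d) ℤ := Matrix.of u with hUdef
  have hWU : edgeMatrix v = ((d : ℤ) + 1) • U := by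
    ext i j
    exact congrFun (hu i) j
  have hU : IsUnit U.det := by
    rw [Int.isUnit_iff_natAbs_eq]
    have h1 := hD
    have h2 : ((d : ℤ) + 1).natAbs = d + 1 := by omega
    rw [hWU, Matrix.det_smul, Fintype.card_fin, Int.natAbs_mul, Int.natAbs_pow, h2, hm,
      ← pow_succ', Nat.sub_add_cancel hd] at h1
    exact Nat.eq_of_mul_eq_mul_left (by positivity) (h1.trans (mul_one _).symm)
  have hsucc : ∀ i : Fin d, v i.succ = v 0 + ((d : ℤ) + 1) • u i := by
    intro i
    rw [← hu i]
    exact (add_sub_cancel _ _).symm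
  have hvsum : ∑ i, v i = 0 := by
    apply toR_injective
    have hD0 : (0 : ℝ) < (edgeMatrix v).det.natAbs := by
      rw [hD]
      exact_mod_cast Nat.mul_pos (Nat.succ_pos d) hm0
    have h1 := congrArg (fun x => ((edgeMatrix v).det.natAbs : ℝ) • x) ht0
    simp only [Finset.smul_sum, smul_smul, ← hb, smul_zero] at h1
    rw [← Finset.smul_sum] at h1
    have h2 := (smul_eq_zero.mp h1).resolve_left (by exact_mod_cast hm0.ne')
    have h3 := toR_smul_sum (fun _ => (1 : ℤ)) v
    simp only [one_smul, Int.cast_one] at h3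
    rw [h3, h2]
    ext
    simp [toR]
  have hv0 : v 0 = -∑ i, u i := by
    rw [Fin.sum_univ_succ] at hvsum
    simp only [hsucc, Finset.sum_add_distrib, ← Finset.smul_sum] at hvsum
    ext j
    have h1 := congrFun hvsum j
    simp only [Pi.add_apply, Finset.sum_const, Finset.card_univ, Fintype.card_fin, Pi.smul_apply,
      smul_eq_mul, nsmul_eq_mul, Pi.zero_apply, Pi.mul_apply, Pi.natCast_apply] at h1
    have h2 : ((d : ℤ) + 1) ≠ 0 := by omega
    apply mul_left_cancel₀ h2
    rw [Pi.neg_apply]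
    linarith
  have hUt : IsUnit Uᵀ.det := by rwa [Matrix.det_transpose]
  have hvec : ∀ y : Fin d → ℤ, Uᵀ *ᵥ y = ∑ j, y j • u j := by
    intro y
    rw [Matrix.mulVec_transpose, Matrix.vecMul_eq_sum]
    rfl
  refine unimodEquiv_of_transpose_mulVec hUt fun i => ?_
  rw [hvec]
  refine Fin.cases ?_ (fun i => ?_) i
  · rw [hv0]
    simp [lowDimV]
  · rw [hsucc, hv0]
    simp only [lowDimV, Fin.val_succ, add_left_inj, Fin.val_inj, sub_smul, ite_smul, zero_smul,
      one_smul, Finset.sum_sub_distrib, Finset.sum_ite_eq', mem_univ, if_true]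
    abel

theorem triangle_bound {m a b c : ℕ} (ha : 0 < a) (hab : a ≤ b) (hac : a ≤ c)
    (h : m * (b * c) ≤ a + b + c) : m ≤ 3 ∧ (m = 3 → a = 1 ∧ b = 1 ∧ c = 1) := by
  wlog hbc : b ≤ c generalizing b c
  · obtain ⟨h1, h2⟩ := this hac hab (by linarith) (le_of_not_ge hbc)
    exact ⟨h1, fun hm => ⟨(h2 hm).1, (h2 hm).2.2, (h2 hm).2.1⟩⟩
  have hc : 0 < c := ha.trans_le hac
  have h1 : m * b ≤ 3 := by
    refine Nat.le_of_mul_le_mul_right ?_ hc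
    linarith
  refine ⟨(Nat.le_mul_of_pos_right m (ha.trans_le hab)).trans h1, ?_⟩
  rintro rfl
  have hb : b = 1 := by omega
  subst hb
  omega

theorem tetrahedron_bound_of_le {m a b c d : ℕ} (ha : 0 < a) (hab : a ≤ b) (hbc : b ≤ c)
    (hcd : c ≤ d) (hd : d ≤ a + b + c) (h : m * (b * c * d) ≤ (a + b + c + d) ^ 2) :
    m ≤ 16 ∧ (m = 16 → a = 1 ∧ b = 1 ∧ c = 1 ∧ d = 1) := by
  have hc : 0 < c := by omega
  have hd0 : 0 < d := by omega
  have h1 : (a + b + c + d) ^ 2 * c ≤ (a + b + c + c) ^ 2 * d := by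
    obtain ⟨x, rfl⟩ := Nat.exists_eq_add_of_le hcd
    have h2 : c * (c + x) ≤ (a + b + c) * (a + b + c) :=
      Nat.mul_le_mul (by omega) hd
    nlinarith [Nat.mul_le_mul_left x h2]
  have h2 : m * b * (c * c) ≤ (a + b + c + c) ^ 2 := by
    refine Nat.le_of_mul_le_mul_right ?_ hd0
    refine le_trans ?_ h1
    nlinarith [Nat.mul_le_mul_right c h]
  have h3 : (a + b + c + c) ^ 2 ≤ (4 * c) ^ 2 := Nat.pow_le_pow_left (by omega) 2
  have h4 : m * b ≤ 16 := by
    refine Nat.le_of_mul_le_mul_right ?_ (Nat.mul_pos hc hc)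
    linarith
  refine ⟨(Nat.le_mul_of_pos_right m (ha.trans_le hab)).trans h4, ?_⟩
  rintro rfl
  have hb : b = 1 := by omega
  have ha1 : a = 1 := by omega
  subst hb ha1
  have hc1 : c = 1 := by
    have h5 : (4 * c) ^ 2 ≤ (1 + 1 + c + c) ^ 2 := by linarith
    have := (Nat.pow_le_pow_iff_left two_ne_zero).mp h5
    omega
  subst hc1
  refine ⟨rfl, rfl, rfl, ?_⟩
  interval_cases d <;> omega

theorem tetrahedron_bound {m a b c d : ℕ} (ha : 0 < a) (hab : a ≤ b) (hac : a ≤ c) (had : a ≤ d)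
    (hb : b ≤ a + c + d) (hc : c ≤ a + b + d) (hd : d ≤ a + b + c)
    (h : m * (b * c * d) ≤ (a + b + c + d) ^ 2) :
    m ≤ 16 ∧ (m = 16 → a = 1 ∧ b = 1 ∧ c = 1 ∧ d = 1) := by
  have key : ∀ x y z : ℕ, a ≤ x → x ≤ y → y ≤ z → z ≤ a + x + y →
      b * c * d = x * y * z → b + c + d = x + y + z →
      m ≤ 16 ∧ (m = 16 → a = 1 ∧ x = 1 ∧ y = 1 ∧ z = 1) := by
    intro x y z h1 h2 h3 h4 h5 h6
    refine tetrahedron_bound_of_le ha h1 h2 h3 h4 ?_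
    rw [← h5]
    convert h using 2
    omega
  rcases le_total b c with h1 | h1 <;> rcases le_total c d with h2 | h2 <;>
    rcases le_total b d with h3 | h3
  · have := key b c d hab h1 h2 (by omega) (by ring) (by ring); tauto
  · have := key b c d hab h1 h2 (by omega) (by ring) (by ring); tauto
  · have := key b d c hab h3 h2 (by omega) (by ring) (by ring); tauto
  · have := key d b c had h3 h1 (by omega) (by ring) (by ring); tauto
  · have := key c b d hac h1 h3 (by omega) (by ring) (by ring); tauto
  · have := key c d b hac h2 h3 (by omega) (by ring) (by ring); tauto
  · have := key d c b had h2 h1 (by omega) (by ring) (by ring); tauto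
  · have := key d c b had h2 h1 (by omega) (by ring) (by ring); tauto

theorem weights_bound {d m : ℕ} (hd1 : 1 ≤ d) (hd3 : d ≤ 3) {l : Fin (d + 1) → ℕ}
    (hpos : 0 < l 0) (hmin : ∀ i, l 0 ≤ l i) (hhalf : ∀ i, 2 * l i ≤ ∑ j, l j)
    (h : m * ∏ i : Fin d, l i.succ ≤ (∑ i, l i) ^ (d - 1)) :
    m ≤ (d + 1) ^ (d - 1) ∧ (m = (d + 1) ^ (d - 1) → ∀ i, l i = 1) := by
  interval_cases d
  · simp [Fin.forall_fin_succ, Fin.sum_univ_succ] at *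
    have h1 := Nat.mul_le_mul_left m hmin
    have h2 : m ≤ m * l 1 := Nat.le_mul_of_pos_right m (hpos.trans_le hmin)
    refine ⟨h2.trans h, ?_⟩
    rintro rfl
    omega
  · simp [Fin.forall_fin_succ, Fin.sum_univ_succ, Fin.prod_univ_succ] at *
    exact triangle_bound hpos hmin.1 hmin.2 (by linarith)
  · simp [Fin.forall_fin_succ, Fin.sum_univ_succ, Fin.prod_univ_succ] at *
    refine tetrahedron_bound hpos hmin.1 hmin.2.1 hmin.2.2 (by omega) (by omega) (by omega) ?_
    convert h using 2 <;> ring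

theorem IsCanonicalSimplex.mult_bound_of_min {d : ℕ} (hd1 : 1 ≤ d) (hd3 : d ≤ 3)
    {v : Fin (d + 1) → Fin d → ℤ} (hv : IsCanonicalSimplex v) {t : Fin (d + 1) → ℝ}
    (ht : ∀ i, 0 < t i) (ht1 : ∑ i, t i = 1) (ht0 : ∑ i, t i • toR (v i) = 0)
    (hmin : ∀ i, t 0 ≤ t i) :
    mult v ≤ (d + 1) ^ (d - 1) ∧
      (mult v = (d + 1) ^ (d - 1) → UnimodEquiv (hullOf v) (hullOf (lowDimV d))) := by
  obtain ⟨b, hb, hdvd⟩ := exists_integral_weights hv.1 ht ht1 ht0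
  have hD0 : 0 < (edgeMatrix v).det.natAbs := by
    have := det_edgeMatrix_ne_zero hv.1
    omega
  have hprod := hv.prod_weights_le ht ht1 ht0 hb
  set D := (edgeMatrix v).det.natAbs with hD
  have hDR : (0 : ℝ) < D := by exact_mod_cast hD0
  choose l hl using hdvd
  set m := mult v with hm
  have hsum : ∑ i, b i = D := by
    have : ∑ i, (b i : ℝ) = D := by
      rw [Finset.sum_congr rfl fun i _ => hb i, ← Finset.mul_sum, ht1, mul_one]
    exact_mod_cast this
  have hbpos : ∀ i, 0 < b i := by
    intro i
    have : (0 : ℝ) < b i := by rw [hb]; exact mul_pos hDR (ht i)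
    exact_mod_cast this
  have hbmin : ∀ i, b 0 ≤ b i := by
    intro i
    have : (b 0 : ℝ) ≤ b i := by
      rw [hb, hb]
      exact mul_le_mul_of_nonneg_left (hmin i) hDR.le
    exact_mod_cast this
  have hbhalf : ∀ i, 2 * b i ≤ D := by
    intro i
    have h1 := hv.barycentric_le_half hd1 ht ht1 ht0 i
    have : 2 * (b i : ℝ) ≤ D := by
      rw [hb]
      nlinarith
    exact_mod_cast this
  have hm0 : 0 < m := by
    have := hbpos 0
    rw [hl] at this
    exact Nat.pos_of_mul_pos_right this
  have hDl : D = m * ∑ i, l i := by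
    rw [← hsum, Finset.mul_sum]
    exact Finset.sum_congr rfl fun i _ => hl i
  have hlprod : m * ∏ i : Fin d, l i.succ ≤ (∑ i, l i) ^ (d - 1) := by
    simp only [hl, Finset.prod_mul_distrib, Finset.prod_const, Finset.card_univ,
      Fintype.card_fin] at hprod
    rw [hDl, mul_pow] at hprod
    refine Nat.le_of_mul_le_mul_left ?_ (pow_pos hm0 (d - 1))
    rwa [← mul_assoc, ← pow_succ, Nat.sub_add_cancel hd1]
  obtain ⟨h1, h2⟩ := weights_bound hd1 hd3 (l := l)
    (by have := hbpos 0; rw [hl] at this; exact Nat.pos_of_mul_pos_left this)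
    (fun i => by
      have := hbmin i
      rw [hl, hl i] at this
      exact Nat.le_of_mul_le_mul_left this hm0)
    (fun i => by
      have := hbhalf i
      rw [hl i, hDl, mul_left_comm] at this
      exact Nat.le_of_mul_le_mul_left this hm0) hlprod
  refine ⟨h1, fun heq => hv.unimodEquiv_of_weights_eq hd1 ht ht1 ht0 (m := m) ?_ heq⟩
  intro i
  rw [← hb, hl, h2 heq i, mul_one]

theorem hullOf_comp_equiv {d : ℕ} (v : Fin (d + 1) → Fin d → ℤ) (e : Equiv.Perm (Fin (d + 1))) :
    hullOf (v ∘ e) = hullOf v := by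
  rw [hullOf, hullOf]
  congr 1
  exact e.surjective.range_comp fun i => toR (v i)

theorem mult_comp_equiv {d : ℕ} (v : Fin (d + 1) → Fin d → ℤ) (e : Equiv.Perm (Fin (d + 1))) :
    mult (v ∘ e) = mult v := by
  rw [mult, mult, e.surjective.range_comp]

theorem IsCanonicalSimplex.comp_equiv {d : ℕ} {v : Fin (d + 1) → Fin d → ℤ}
    (hv : IsCanonicalSimplex v) (e : Equiv.Perm (Fin (d + 1))) : IsCanonicalSimplex (v ∘ e) := by
  rw [IsCanonicalSimplex, hullOf_comp_equiv]
  exact ⟨hv.1.comp_embedding e.toEmbedding, hv.2⟩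

theorem IsCanonicalSimplex.mult_bound {d : ℕ} (hd1 : 1 ≤ d) (hd3 : d ≤ 3)
    {v : Fin (d + 1) → Fin d → ℤ} (hv : IsCanonicalSimplex v) :
    mult v ≤ (d + 1) ^ (d - 1) ∧
      (mult v = (d + 1) ^ (d - 1) → UnimodEquiv (hullOf v) (hullOf (lowDimV d))) := by
  obtain ⟨t, ht, ht1, ht0⟩ := hv.exists_barycentric
  obtain ⟨j, hj⟩ := Finite.exists_min t
  set e := Equiv.swap 0 j with he
  have := (hv.comp_equiv e).mult_bound_of_min hd1 hd3 (t := t ∘ e) (fun i => ht _)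
    (by rw [← ht1]; exact Equiv.sum_comp e t)
    (by rw [← ht0]; exact Equiv.sum_comp e fun i => t i • toR (v i))
    (fun i => by simpa [he] using hj (Equiv.swap 0 j i))
  rwa [mult_comp_equiv, hullOf_comp_equiv] at this

end

/-- For `1 ≤ d ≤ 3`, a `d`-dimensional canonical lattice simplex has multiplicity
at most `(d+1)^(d-1)`, with equality iff it is unimodularly equivalent to
`conv{0, (d+1) e_1, …, (d+1) e_d} - (1,…,1)`. -/
theorem mult_le_of_canonical_lowDim {d : ℕ} (hd1 : 1 ≤ d) (hd3 : d ≤ 3)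
    (v : Fin (d + 1) → Fin d → ℤ) (hv : IsCanonicalSimplex v) :
    mult v ≤ (d + 1) ^ (d - 1) ∧
      (mult v = (d + 1) ^ (d - 1) ↔ UnimodEquiv (hullOf v) (hullOf (lowDimV d))) := by
  refine ⟨(hv.mult_bound hd1 hd3).1, (hv.mult_bound hd1 hd3).2, fun h => ?_⟩
  rw [hv.mult_eq_of_unimodEquiv h, mult_lowDimV hd1 hd3]
end
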